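/- arXiv:0707.3658 — 2 statements merged into one kernel-verified Lean document; each statement's English description precedes it below -/
import Mathlib

section
/- Let G be a finitely generated group with finite symmetric generating set S and word length L_S, and suppose the metric d(g,h) := L_S(g⁻¹h) on G satisfies the Gromov four-point δ-hyperbolicity condition for some δ ≥ 0. Then for every element h ∈ G of infinite order, the cyclic subgroup ⟨h⟩ generated by h has finite index in the centralizer C_G(h) of h in G; in particular C_G(h) is virtually cyclic and the quotient C_G(h)/⟨h⟩ is finite. (Centralizer structure used in Proposition 2.1.2(ii),(iii).) -/
/-- The word length of `g` with respect to a generating set `S`: the least length of a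
list of elements of `S` with product `g`. -/
noncomputable def wordLength {G : Type*} [Group G] (S : Set G) (g : G) : ℕ :=
  sInf {n : ℕ | ∃ l : List G, (∀ x ∈ l, x ∈ S) ∧ l.length = n ∧ l.prod = g}

section WordLength

variable {G : Type*} [Group G] {S : Set G}

theorem wordLength_prod_le {l : List G} (hl : ∀ x ∈ l, x ∈ S) :
    wordLength S l.prod ≤ l.length :=
  Nat.sInf_le ⟨l, hl, rfl, rfl⟩

theorem exists_list_length_eq_wordLength (hsymm : ∀ s ∈ S, s⁻¹ ∈ S)
    (hgen : Subgroup.closure S = ⊤) (g : G) :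
    ∃ l : List G, (∀ x ∈ l, x ∈ S) ∧ l.length = wordLength S g ∧ l.prod = g := by
  have hg : g ∈ Subgroup.closure S := hgen ▸ Subgroup.mem_top g
  rw [← Subgroup.mem_toSubmonoid, Subgroup.closure_toSubmonoid] at hg
  obtain ⟨l, hl, hprod⟩ := Submonoid.exists_list_of_mem_closure hg
  refine Nat.sInf_mem (s := {n : ℕ | ∃ l : List G, (∀ x ∈ l, x ∈ S) ∧ l.length = n ∧ l.prod = g})
    ⟨l.length, l, fun x hx => ?_, rfl, hprod⟩
  rcases hl x hx with h | h
  · exact h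
  · simpa using hsymm _ h

theorem wordLength_mul_le (hsymm : ∀ s ∈ S, s⁻¹ ∈ S) (hgen : Subgroup.closure S = ⊤) (g h : G) :
    wordLength S (g * h) ≤ wordLength S g + wordLength S h := by
  obtain ⟨l, hl, hll, rfl⟩ := exists_list_length_eq_wordLength hsymm hgen g
  obtain ⟨k, hk, hkl, rfl⟩ := exists_list_length_eq_wordLength hsymm hgen h
  rw [← hll, ← hkl, ← List.prod_append, ← List.length_append]
  exact wordLength_prod_le fun x hx => (List.mem_append.1 hx).elim (hl x) (hk x)

theorem wordLength_inv_le (hsymm : ∀ s ∈ S, s⁻¹ ∈ S) (hgen : Subgroup.closure S = ⊤) (g : G) :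
    wordLength S g⁻¹ ≤ wordLength S g := by
  obtain ⟨l, hl, hll, rfl⟩ := exists_list_length_eq_wordLength hsymm hgen g
  rw [← hll, List.prod_inv_reverse]
  refine (wordLength_prod_le fun x hx => ?_).trans_eq (by simp)
  simp only [List.mem_reverse, List.mem_map] at hx
  obtain ⟨y, hy, rfl⟩ := hx
  exact hsymm y (hl y hy)

theorem wordLength_inv (hsymm : ∀ s ∈ S, s⁻¹ ∈ S) (hgen : Subgroup.closure S = ⊤) (g : G) :
    wordLength S g⁻¹ = wordLength S g :=
  (wordLength_inv_le hsymm hgen g).antisymm (by simpa using wordLength_inv_le hsymm hgen g⁻¹)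

theorem wordLength_one : wordLength S (1 : G) = 0 :=
  Nat.le_zero.1 (wordLength_prod_le (l := []) (by simp))

theorem finite_setOf_wordLength_le (hfin : S.Finite) (hsymm : ∀ s ∈ S, s⁻¹ ∈ S)
    (hgen : Subgroup.closure S = ⊤) (n : ℕ) : {g : G | wordLength S g ≤ n}.Finite := by
  have := hfin.to_subtype
  refine ((List.finite_length_le S n).image fun l => (l.map (↑)).prod).subset fun g hg => ?_
  obtain ⟨l, hl, hll, rfl⟩ := exists_list_length_eq_wordLength hsymm hgen g
  lift l to List S using hl
  exact ⟨l, by simpa using hll.trans_le hg, rfl⟩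

theorem exists_wordLength_midpoint (hsymm : ∀ s ∈ S, s⁻¹ ∈ S) (hgen : Subgroup.closure S = ⊤)
    (g : G) : ∃ m : G, 2 * wordLength S m ≤ wordLength S g + 1 ∧
      2 * wordLength S (m⁻¹ * g) ≤ wordLength S g + 1 := by
  obtain ⟨l, hl, hll, rfl⟩ := exists_list_length_eq_wordLength hsymm hgen g
  have h₁ := wordLength_prod_le (l := l.take (l.length / 2)) fun x hx =>
    hl x (List.mem_of_mem_take hx)
  have h₂ := wordLength_prod_le (l := l.drop (l.length / 2)) fun x hx =>
    hl x (List.mem_of_mem_drop hx)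
  refine ⟨(l.take (l.length / 2)).prod, ?_, ?_⟩
  · rw [List.length_take] at h₁
    omega
  · have h : (l.take (l.length / 2)).prod⁻¹ * l.prod = (l.drop (l.length / 2)).prod := by
      rw [inv_mul_eq_iff_eq_mul, List.prod_take_mul_prod_drop]
    rw [List.length_drop] at h₂
    rw [h]
    omega

end WordLength

/-- A length function on a group whose associated left-invariant metric is proper, roughly geodesic
(in the weak sense that approximate midpoints exist) and satisfies the four-point
`δ`-hyperbolicity condition. -/
structure IsHyperbolicLength {G : Type*} [Group G] (L : G → ℝ) (δ : ℝ) : Prop where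
  map_one : L 1 = 0
  map_inv (g : G) : L g⁻¹ = L g
  map_mul_le (g h : G) : L (g * h) ≤ L g + L h
  exists_midpoint (g : G) : ∃ m : G, 2 * L m ≤ L g + 1 ∧ 2 * L (m⁻¹ * g) ≤ L g + 1
  finite_ball (r : ℝ) : {g : G | L g ≤ r}.Finite
  four_point (w x y z : G) : L (w⁻¹ * x) + L (y⁻¹ * z) ≤
    max (L (w⁻¹ * y) + L (x⁻¹ * z)) (L (w⁻¹ * z) + L (x⁻¹ * y)) + 2 * δ

namespace IsHyperbolicLength

variable {G : Type*} [Group G] {L : G → ℝ} {δ : ℝ}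

theorem nonneg (hL : IsHyperbolicLength L δ) (g : G) : 0 ≤ L g := by
  have h := hL.map_mul_le g g⁻¹
  rw [mul_inv_cancel, hL.map_one, hL.map_inv] at h
  linarith

theorem inv_mul_comm (hL : IsHyperbolicLength L δ) (g h : G) : L (g⁻¹ * h) = L (h⁻¹ * g) := by
  rw [← hL.map_inv, mul_inv_rev, inv_inv]

theorem four_point_pow (hL : IsHyperbolicLength L δ) (g : G) (p q r : ℕ) :
    L (g ^ (p + q)) + L (g ^ (q + r)) ≤
      max (L (g ^ p) + L (g ^ r)) (L (g ^ q) + L (g ^ (p + q + r))) + 2 * δ := by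
  have h := hL.four_point 1 (g ^ (p + q)) (g ^ p) (g ^ (p + q + r))
  rw [hL.inv_mul_comm (g ^ (p + q)) (g ^ p)] at h
  have e₁ : (g ^ p)⁻¹ * g ^ (p + q + r) = g ^ (q + r) := by
    rw [add_assoc, pow_add, inv_mul_cancel_left]
  have e₂ : (g ^ (p + q))⁻¹ * g ^ (p + q + r) = g ^ r := by
    rw [pow_add _ (p + q), inv_mul_cancel_left]
  have e₃ : (g ^ p)⁻¹ * g ^ (p + q) = g ^ q := by rw [pow_add, inv_mul_cancel_left]
  rwa [e₁, e₂, e₃, inv_one, one_mul, one_mul, one_mul, add_comm (L (g ^ (p + q + r)))] at h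

theorem exists_lt_pow (hL : IsHyperbolicLength L δ) {h : G} (hh : ¬ IsOfFinOrder h) (r : ℝ) :
    ∃ n : ℕ, r < L (h ^ n) := by
  by_contra! hr
  exact Set.infinite_range_of_injective (injective_pow_iff_not_isOfFinOrder.2 hh)
    ((hL.finite_ball r).subset (by rintro _ ⟨n, rfl⟩; exact hr n))

theorem exists_pow_record (hL : IsHyperbolicLength L δ) {h : G} (hh : ¬ IsOfFinOrder h) (N : ℕ) :
    ∃ k : ℕ, N < k ∧ ∀ j ≤ k, L (h ^ j) ≤ L (h ^ k) := by
  classical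
  have ex := hL.exists_lt_pow hh (∑ j ∈ Finset.range (N + 1), L (h ^ j))
  refine ⟨Nat.find ex, ?_, fun j hj => ?_⟩
  · by_contra! hle
    refine (Nat.find_spec ex).not_ge ?_
    exact Finset.single_le_sum (f := fun j => L (h ^ j)) (fun j _ => hL.nonneg _)
      (Finset.mem_range.2 (Nat.lt_succ_of_le hle))
  · rcases hj.eq_or_lt with rfl | hj
    · exact le_rfl
    · exact (not_lt.1 (Nat.find_min ex hj)).trans (Nat.find_spec ex).le

/-- Distances to an approximate midpoint of a segment are controlled by distances to its ends. -/
theorem midpoint_le (hL : IsHyperbolicLength L δ) {g m : G} (hm : 2 * L m ≤ L g + 1)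
    (hm' : 2 * L (m⁻¹ * g) ≤ L g + 1) {z : G} {r : ℝ} (hz : L z ≤ r) (hz' : L (z⁻¹ * g) ≤ r) :
    L (m⁻¹ * z) ≤ r - (L g - 1) / 2 + 2 * δ := by
  have h := hL.four_point m z 1 g
  simp only [inv_one, one_mul, mul_one, hL.map_inv] at h
  have : max (L m + L (z⁻¹ * g)) (L (m⁻¹ * g) + L z) ≤ (L g + 1) / 2 + r :=
    max_le (by linarith) (by linarith)
  linarith

/-- If the length of `h ^ k` is maximal among the first `k` powers and hardly grows when
passing to `h ^ (2 * k)`, then all the first `k` powers almost fix the midpoint of `1` and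
`h ^ k`. -/
theorem exists_conj_pow_le (hL : IsHyperbolicLength L δ) (hδ : 0 ≤ δ) {h : G} {k : ℕ} {c : ℝ}
    (hc : 0 ≤ c) (hk : ∀ j ≤ k, L (h ^ j) ≤ L (h ^ k)) (hk2 : L (h ^ (2 * k)) ≤ L (h ^ k) + c) :
    ∃ m : G, ∀ j ≤ k, L (m⁻¹ * h ^ j * m) ≤ c + 6 * δ + 1 := by
  obtain ⟨m, hm, hm'⟩ := hL.exists_midpoint (h ^ k)
  refine ⟨m, fun j hj => ?_⟩
  have h₁ : L (h ^ j) ≤ L (h ^ k) := hk j hj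
  have h₂ : L ((h ^ j)⁻¹ * h ^ k) ≤ L (h ^ k) := by
    rw [inv_mul_eq_iff_eq_mul.2 (pow_mul_pow_sub h hj).symm]
    exact hk _ (Nat.sub_le k j)
  have h₃ : L (h ^ j * h ^ k) ≤ L (h ^ k) + c + 2 * δ := by
    have h₄ := hL.four_point_pow h k j (k - j)
    rw [Nat.add_sub_cancel' hj, show k + j + (k - j) = 2 * k by omega] at h₄
    rw [← pow_add, add_comm j]
    have : max (L (h ^ k) + L (h ^ (k - j))) (L (h ^ j) + L (h ^ (2 * k))) ≤ 2 * L (h ^ k) + c :=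
      max_le (by linarith [hk _ (Nat.sub_le k j)]) (by linarith)
    linarith
  have aux : L (m⁻¹ * (h ^ j)⁻¹) ≤ L (h ^ k) + c + 2 * δ - (L (h ^ k) - 1) / 2 + 2 * δ := by
    refine hL.midpoint_le hm hm' ?_ ?_
    · rw [hL.map_inv]; linarith
    · rwa [inv_inv]
  have aux' : L (m⁻¹ * ((h ^ j)⁻¹ * h ^ k)) ≤
      L (h ^ k) + c + 2 * δ - (L (h ^ k) - 1) / 2 + 2 * δ := by
    refine hL.midpoint_le hm hm' (by linarith) ?_
    rw [mul_inv_rev, inv_inv, mul_assoc, (Commute.pow_pow_self h j k).eq, inv_mul_cancel_left]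
    linarith
  have := hL.midpoint_le hm hm' (z := h ^ j * m)
    (r := L (h ^ k) + c + 2 * δ - (L (h ^ k) - 1) / 2 + 2 * δ) ?_ ?_
  · rw [mul_assoc]
    linarith
  · rwa [← hL.map_inv, mul_inv_rev]
  · rwa [mul_inv_rev, mul_assoc]

theorem exists_pow_two_mul_lt (hL : IsHyperbolicLength L δ) (hδ : 0 ≤ δ) {h : G}
    (hh : ¬ IsOfFinOrder h) {c : ℝ} (hc : 0 ≤ c) :
    ∃ k : ℕ, L (h ^ k) + c < L (h ^ (2 * k)) := by
  have hfin := hL.finite_ball (c + 6 * δ + 1)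
  obtain ⟨k, hNk, hk⟩ := hL.exists_pow_record hh hfin.toFinset.card
  refine ⟨k, ?_⟩
  by_contra! hk2
  obtain ⟨m, hm⟩ := hL.exists_conj_pow_le hδ hc hk hk2
  have hcard : (Finset.range (k + 1)).card ≤ hfin.toFinset.card := by
    refine Finset.card_le_card_of_injOn (fun j => m⁻¹ * h ^ j * m) (fun j hj => ?_) ?_
    · simpa using hm j (Nat.lt_succ_iff.1 (by simpa using hj))
    · intro i _ j _ hij
      exact injective_pow_iff_not_isOfFinOrder.2 hh (mul_left_cancel (mul_right_cancel hij))
  rw [Finset.card_range] at hcard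
  omega

theorem pow_succ_ge (hL : IsHyperbolicLength L δ) (hδ : 0 ≤ δ) {g : G} {ε : ℝ} (hε : 0 < ε)
    (hg : L g + 2 * δ + ε ≤ L (g ^ 2)) (n : ℕ) : L (g ^ n) + ε ≤ L (g ^ (n + 1)) := by
  induction n with
  | zero =>
    have h := hL.map_mul_le g g
    rw [← sq] at h
    simp only [pow_zero, hL.map_one, zero_add, pow_one]
    linarith
  | succ n ih =>
    have h := hL.four_point_pow g 1 1 n
    rw [pow_one, add_comm 1 n, one_add_one_eq_two, add_comm 2 n] at h
    rcases le_max_iff.1 (sub_le_iff_le_add.2 h) with h | h <;> linarith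

theorem pow_add_pow_le (hL : IsHyperbolicLength L δ) (hδ : 0 ≤ δ) {g : G} {ε : ℝ} (hε : δ < ε)
    (hg : L g + 2 * δ + ε ≤ L (g ^ 2)) (m n : ℕ) :
    L (g ^ m) + L (g ^ n) ≤ L (g ^ (m + n)) + L g + 2 * δ := by
  have hε0 := hδ.trans_lt hε
  have hm := hL.pow_succ_ge hδ hε0 hg m
  cases n with
  | zero =>
    simp only [pow_zero, hL.map_one, add_zero]
    linarith [hL.nonneg g]
  | succ n =>
    have hn := hL.pow_succ_ge hδ hε0 hg n
    have h := hL.four_point_pow g m 1 n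
    rw [pow_one, add_comm 1 n, add_right_comm, add_assoc] at h
    rcases le_max_iff.1 (sub_le_iff_le_add.2 h) with h | h <;> linarith

theorem mul_le_pow (hL : IsHyperbolicLength L δ) (hδ : 0 ≤ δ) {g : G} {ε : ℝ} (hε : 0 < ε)
    (hg : L g + 2 * δ + ε ≤ L (g ^ 2)) (n : ℕ) : n * ε ≤ L (g ^ n) := by
  induction n with
  | zero => simp [hL.map_one]
  | succ n ih =>
    have := hL.pow_succ_ge hδ hε hg n
    push_cast
    linarith

theorem le_max_mul_pow (hL : IsHyperbolicLength L δ) {g x : G} {K : ℝ} {n : ℕ}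
    (hgx : Commute g x) (hK : 2 * L (g ^ n) ≤ L (g ^ (n + n)) + K) :
    L (g ^ n) + L x - K - 2 * δ ≤ max (L (x * g ^ n)) (L (x⁻¹ * g ^ n)) := by
  have h := hL.four_point 1 (g ^ (n + n)) (x * g ^ n) (g ^ n)
  have e₁ : (x * g ^ n)⁻¹ * g ^ n = x⁻¹ := by
    rw [← (hgx.pow_left n).eq, mul_inv_rev, inv_mul_cancel_right]
  have e₂ : (g ^ n)⁻¹ * g ^ (n + n) = g ^ n := by rw [pow_add, inv_mul_cancel_left]
  have e₃ : (x * g ^ n)⁻¹ * g ^ (n + n) = x⁻¹ * g ^ n := by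
    rw [← (hgx.pow_left n).eq, mul_inv_rev, pow_add, mul_assoc, inv_mul_cancel_left]
  rw [hL.inv_mul_comm (g ^ (n + n)) (g ^ n), hL.inv_mul_comm (g ^ (n + n)) (x * g ^ n), e₁, e₂, e₃, hL.map_inv, inv_one,
    one_mul, one_mul, one_mul, add_comm (L (g ^ n)), max_add_add_right] at h
  linarith

theorem mul_pow_add_inv_mul_pow_le (hL : IsHyperbolicLength L δ) {g x : G} {n : ℕ}
    (hgx : Commute g x) (hn : L x ≤ L (g ^ n)) :
    L (x * g ^ n) + L (x⁻¹ * g ^ n) ≤ 2 * L (g ^ n) + 2 * δ := by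
  have h := hL.four_point 1 (x * g ^ n) x (g ^ n)
  have e₁ : (x * g ^ n)⁻¹ * g ^ n = x⁻¹ := by
    rw [← (hgx.pow_left n).eq, mul_inv_rev, inv_mul_cancel_right]
  rw [hL.inv_mul_comm (x * g ^ n) x, e₁, inv_mul_cancel_left, hL.map_inv, inv_one,
    one_mul, one_mul, one_mul, max_eq_right (by linarith)] at h
  linarith

theorem inv_mul_pow_le (hL : IsHyperbolicLength L δ) {g x : G} {K A B : ℝ} {k n : ℕ} (hkn : k ≤ n)
    (hK : L (g ^ k) + L (g ^ (n - k)) ≤ L (g ^ n) + K) (hk : L (g ^ k) ≤ L x)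
    (hk' : L x ≤ L (g ^ k) + A) (hn : L (x⁻¹ * g ^ n) ≤ L (g ^ n) - L x + B) :
    L (x⁻¹ * g ^ k) ≤ max (A + K) B + 2 * δ := by
  have h := hL.four_point 1 (g ^ n) x (g ^ k)
  have e₁ : (g ^ k)⁻¹ * g ^ n = g ^ (n - k) := inv_mul_eq_iff_eq_mul.2 (pow_mul_pow_sub g hkn).symm
  rw [hL.inv_mul_comm (g ^ n) (g ^ k), hL.inv_mul_comm (g ^ n) x, e₁, inv_one, one_mul, one_mul, one_mul] at h
  have : max (L x + L (g ^ (n - k))) (L (g ^ k) + L (x⁻¹ * g ^ n)) ≤ L (g ^ n) + max (A + K) B :=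
    max_le (by linarith [le_max_left (A + K) B]) (by linarith [le_max_right (A + K) B])
  linarith

/-- Elements commuting with a loxodromic element `g` stay uniformly close to `⟨g⟩`. -/
theorem exists_mem_zpowers_mul_le (hL : IsHyperbolicLength L δ) (hδ : 0 ≤ δ) {g : G} {ε : ℝ}
    (hε : δ < ε) (hg : L g + 2 * δ + ε ≤ L (g ^ 2)) {x : G} (hgx : Commute g x) :
    ∃ z ∈ Subgroup.zpowers g, L (x * z) ≤ 2 * L g + 8 * δ := by
  classical
  have hε0 := hδ.trans_lt hε
  have hmono : Monotone fun n : ℕ => L (g ^ n) :=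
    monotone_nat_of_le_succ fun n => by linarith [hL.pow_succ_ge hδ hε0 hg n]
  have hunb : ∃ n : ℕ, L x < L (g ^ (n + 1)) := by
    obtain ⟨n, hn⟩ := Archimedean.arch (L x) hε0
    refine ⟨n, ?_⟩
    have := hL.mul_le_pow hδ hε0 hg n
    rw [nsmul_eq_mul] at hn
    linarith [hL.pow_succ_ge hδ hε0 hg n]
  obtain ⟨k, hk, hk'⟩ : ∃ k : ℕ, L (g ^ k) ≤ L x ∧ L x < L (g ^ (k + 1)) := by
    refine ⟨Nat.find hunb, ?_, Nat.find_spec hunb⟩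
    cases hf : Nat.find hunb with
    | zero => simpa [hL.map_one] using hL.nonneg x
    | succ m => exact not_lt.1 (Nat.find_min hunb (hf ▸ Nat.lt_succ_self m))
  have hk'' : L x ≤ L (g ^ k) + L g := by
    rw [pow_succ] at hk'
    exact hk'.le.trans (hL.map_mul_le _ _)
  have hK := hL.pow_add_pow_le hδ hε hg
  have hmax := hL.le_max_mul_pow (n := k + 1) (K := L g + 2 * δ) hgx
    (by linarith [hK (k + 1) (k + 1)])
  have hsum := hL.mul_pow_add_inv_mul_pow_le hgx hk'.le
  have hKk : L (g ^ k) + L (g ^ (k + 1 - k)) ≤ L (g ^ (k + 1)) + (L g + 2 * δ) := by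
    simpa [add_assoc] using hK k 1
  have hend : max (L g + (L g + 2 * δ)) (L g + 6 * δ) + 2 * δ ≤ 2 * L g + 8 * δ := by
    rcases max_choice (L g + (L g + 2 * δ)) (L g + 6 * δ) with h | h <;> rw [h] <;>
      linarith [hL.nonneg g]
  have hmem : g ^ k ∈ Subgroup.zpowers g := Subgroup.npow_mem_zpowers g k
  rcases le_max_iff.1 hmax with h | h
  · refine ⟨(g ^ k)⁻¹, inv_mem hmem, ?_⟩
    rw [← hL.map_inv, mul_inv_rev, inv_inv, ((hgx.pow_left k).inv_right).eq]
    exact (hL.inv_mul_pow_le k.le_succ hKk hk hk'' (by linarith)).trans hend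
  · refine ⟨g ^ k, hmem, ?_⟩
    rw [← hL.map_inv x] at hk hk''
    have := hL.inv_mul_pow_le (x := x⁻¹) (B := L g + 6 * δ) k.le_succ hKk hk hk''
      (by rw [inv_inv, hL.map_inv]; linarith)
    rw [inv_inv] at this
    exact this.trans hend

theorem finite_centralizer_quotient_zpowers (hL : IsHyperbolicLength L δ) (hδ : 0 ≤ δ) {h : G}
    (hh : ¬ IsOfFinOrder h) :
    Finite (Subgroup.centralizer {h} ⧸
      (Subgroup.zpowers h).subgroupOf (Subgroup.centralizer {h})) := by
  obtain ⟨k, hk⟩ := hL.exists_pow_two_mul_lt hδ hh (c := 3 * δ + 1) (by linarith)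
  set r := 2 * L (h ^ k) + 8 * δ
  have := ((hL.finite_ball r).preimage
    (Subtype.val_injective (p := (· ∈ Subgroup.centralizer {h})).injOn)).to_subtype
  refine Finite.of_surjective
    (fun y : (Subtype.val : Subgroup.centralizer {h} → G) ⁻¹' {g | L g ≤ r} =>
      (QuotientGroup.mk y.1 : Subgroup.centralizer {h} ⧸
        (Subgroup.zpowers h).subgroupOf (Subgroup.centralizer {h}))) fun q => ?_
  obtain ⟨⟨x, hx⟩, rfl⟩ := QuotientGroup.mk_surjective q
  have hhx : Commute h x := (Subgroup.mem_centralizer_singleton_iff.1 hx).symm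
  obtain ⟨z, hz, hzr⟩ := hL.exists_mem_zpowers_mul_le hδ (g := h ^ k) (ε := δ + 1) (by linarith)
    (by rw [← pow_mul, mul_comm k]; linarith) (hhx.pow_left k)
  have hz' : z ∈ Subgroup.zpowers h :=
    Subgroup.zpowers_le.2 (Subgroup.npow_mem_zpowers h k) hz
  have hzc : z ∈ Subgroup.centralizer {h} :=
    Subgroup.zpowers_le.2 (Subgroup.mem_centralizer_singleton_iff.2 rfl) hz'
  refine ⟨⟨⟨x, hx⟩ * ⟨z, hzc⟩, hzr⟩, ?_⟩
  exact QuotientGroup.mk_mul_of_mem _ hz'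

end IsHyperbolicLength

/-- **Centralizer structure (Proposition 2.1.2(ii),(iii)).** In a word-hyperbolic group,
the cyclic subgroup generated by any element `h` of infinite order has finite index in
the centralizer of `h`; in particular the quotient `C_G(h)/⟨h⟩` is finite. -/
theorem stmt_11 {G : Type*} [Group G]
    (S : Finset G) (hsymm : ∀ s ∈ S, s⁻¹ ∈ S)
    (hgen : Subgroup.closure (S : Set G) = ⊤)
    (δ : ℝ) (hδ : 0 ≤ δ)
    (hhyp : ∀ w x y z : G,
      (wordLength (S : Set G) (w⁻¹ * x) : ℝ) + (wordLength (S : Set G) (y⁻¹ * z) : ℝ) ≤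
        max ((wordLength (S : Set G) (w⁻¹ * y) : ℝ) + (wordLength (S : Set G) (x⁻¹ * z) : ℝ))
            ((wordLength (S : Set G) (w⁻¹ * z) : ℝ) + (wordLength (S : Set G) (x⁻¹ * y) : ℝ))
          + 2 * δ) :
    ∀ h : G, ¬ IsOfFinOrder h →
      ((Subgroup.zpowers h).subgroupOf (Subgroup.centralizer {h})).FiniteIndex ∧
      Finite (Subgroup.centralizer {h} ⧸
        (Subgroup.zpowers h).subgroupOf (Subgroup.centralizer {h})) := by
  intro h hh
  have hsymm' : ∀ s ∈ (S : Set G), s⁻¹ ∈ (S : Set G) := by simpa using hsymm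
  have hL : IsHyperbolicLength (fun g : G => (wordLength (S : Set G) g : ℝ)) δ :=
    { map_one := by simp [wordLength_one]
      map_inv := fun g => by simp [wordLength_inv hsymm' hgen]
      map_mul_le := fun g k => by exact_mod_cast wordLength_mul_le hsymm' hgen g k
      exists_midpoint := fun g => by exact_mod_cast exists_wordLength_midpoint hsymm' hgen g
      finite_ball := fun r =>
        (finite_setOf_wordLength_le S.finite_toSet hsymm' hgen ⌊r⌋₊).subset
          fun g hg => Nat.le_floor hg
      four_point := hhyp }
  have hfin := hL.finite_centralizer_quotient_zpowers hδ hh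
  exact ⟨Subgroup.finiteIndex_of_finite_quotient, hfin⟩
end

section
/- Every finitely generated nilpotent group G has finite rational cohomological dimension: there exists N ∈ ℕ such that for every n > N and every ℚ-linear representation M of G, the group cohomology Hⁿ(G; M) vanishes. (Finiteness of rational cohomological dimension of finitely generated nilpotent groups, as used in Proposition 2.1.1(iii).) -/
section

open CategoryTheory

/-- A group has finite rational cohomological dimension if its cohomology with coefficients in
rational representations vanishes in all sufficiently large degrees. -/
def FiniteRationalCD (G : Type) [Group G] : Prop :=
  ∃ N : ℕ, ∀ n : ℕ, n > N → ∀ M : Rep.{0} ℚ G, Subsingleton (groupCohomology M n)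

theorem FiniteRationalCD.of_mulEquiv {G H : Type} [Group G] [Group H] (e : G ≃* H)
    (hG : FiniteRationalCD G) : FiniteRationalCD H := by
  obtain ⟨N, hN⟩ := hG
  refine ⟨N, fun n hn M => ?_⟩
  have := hN n hn (Rep.res e.toMonoidHom M)
  exact (groupCohomology.mapIso (B := Rep.res e.toMonoidHom M) (A := M) e
    (LinearEquiv.refl ℚ M.V) (fun g => rfl) n).symm.toLinearEquiv.toEquiv.subsingleton

/-- The unit of the adjunction between restriction to a subgroup and coinduction. -/
noncomputable def coindUnit {G : Type} [Group G] (S : Subgroup G) (M : Rep.{0} ℚ G) :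
    M ⟶ Rep.coind S.subtype (Rep.res S.subtype M) :=
  Rep.resCoindToHom S.subtype M _ (𝟙 _)

theorem subsingleton_groupCohomology_coind {G : Type} [Group G] {S : Subgroup G} {n : ℕ}
    (A : Rep.{0} ℚ S) (h : Subsingleton (groupCohomology A n)) :
    Subsingleton (groupCohomology (Rep.coind S.subtype A) n) :=
  (groupCohomology.coindIso A n).toLinearEquiv.toEquiv.subsingleton

theorem subsingleton_groupCohomology_of_retract {G : Type} [Group G] {n : ℕ}
    {A B : Rep.{0} ℚ G} (i : A ⟶ B) (r : B ⟶ A) (hir : i ≫ r = 𝟙 A)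
    (h : Subsingleton (groupCohomology B n)) : Subsingleton (groupCohomology A n) := by
  have : (groupCohomology.functor ℚ G n).map i ≫ (groupCohomology.functor ℚ G n).map r = 𝟙 _ := by
    rw [← Functor.map_comp, hir, CategoryTheory.Functor.map_id]
  have key (x : groupCohomology A n) : ((groupCohomology.functor ℚ G n).map r).hom
      (((groupCohomology.functor ℚ G n).map i).hom x) = x :=
    congrArg (fun f => f.hom x) this
  have hinj : Function.Injective ((groupCohomology.functor ℚ G n).map i).hom :=
    Function.LeftInverse.injective key
  exact @Function.Injective.subsingleton _ _ _ hinj h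

theorem subsingleton_groupCohomology_of_shortExact {G : Type} [Group G] {n : ℕ}
    {X : ShortComplex (Rep.{0} ℚ G)} (hX : X.ShortExact)
    (h₂ : Subsingleton (groupCohomology X.X₂ (n + 1)))
    (h₃ : Subsingleton (groupCohomology X.X₃ n)) :
    Subsingleton (groupCohomology X.X₁ (n + 1)) := by
  have hex := groupCohomology.mapShortComplex₁_exact hX (rfl : n + 1 = n + 1)
  rw [← ModuleCat.isZero_iff_subsingleton]
  exact hex.isZero_X₂ ((ModuleCat.isZero_of_subsingleton (groupCohomology X.X₃ n)).eq_of_src _ _)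
    ((ModuleCat.isZero_of_subsingleton (groupCohomology X.X₂ (n + 1))).eq_of_tgt _ _)

section Cyclic

variable {G Q : Type} [Group G] [Group Q] (φ : G →* Q) (M : Rep.{0} ℚ G)

/-- For `f` in the coinduced representation, `g⁻¹ • f g` depends only on the image of `g` in the
quotient. -/
theorem rho_inv_apply_eq_of_map_eq (f : Representation.coindV φ.ker.subtype
    (Rep.res φ.ker.subtype M).ρ) {x y : G} (h : φ x = φ y) :
    M.ρ x⁻¹ (f.1 x) = M.ρ y⁻¹ (f.1 y) := by
  have hn : x * y⁻¹ ∈ φ.ker := by simp [MonoidHom.mem_ker, h]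
  have hf : f.1 (x * y⁻¹ * y) = M.ρ (x * y⁻¹) (f.1 y) := f.2 ⟨_, hn⟩ y
  rw [inv_mul_cancel_right] at hf
  rw [hf, ← Module.End.mul_apply, ← map_mul, inv_mul_cancel_left]

/-- The averaging retraction of the unit `coindUnit` for a normal subgroup of finite index,
presented as the kernel of a surjection with chosen section `s`. -/
noncomputable def coindAverage [Fintype Q] (s : Q → G) (hs : ∀ q, φ (s q) = q) :
    Rep.coind φ.ker.subtype (Rep.res φ.ker.subtype M) ⟶ M :=
  Rep.ofHom
    { toFun := fun f => (Fintype.card Q : ℚ)⁻¹ • ∑ q, M.ρ (s q)⁻¹ (f.1 (s q))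
      map_add' := fun f g => by
        rw [← smul_add, ← Finset.sum_add_distrib]
        congr 1
        exact Finset.sum_congr rfl fun q _ => map_add _ _ _
      map_smul' := fun c f => by
        rw [RingHom.id_apply, smul_comm c]
        congr 1
        rw [Finset.smul_sum]
        exact Finset.sum_congr rfl fun q _ => map_smul (M.ρ (s q)⁻¹) c (f.1 (s q))
      isIntertwining' := fun g => by
        ext f
        change (Fintype.card Q : ℚ)⁻¹ • ∑ q, M.ρ (s q)⁻¹ (f.1 (s q * g)) =
          M.ρ g ((Fintype.card Q : ℚ)⁻¹ • ∑ q, M.ρ (s q)⁻¹ (f.1 (s q)))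
        rw [map_smul, map_sum]
        congr 1
        refine Fintype.sum_equiv (Equiv.mulRight (φ g)) _ _ fun q => ?_
        rw [Equiv.coe_mulRight, rho_inv_apply_eq_of_map_eq φ M f
          (x := s (q * φ g)) (y := s q * g) (by simp [hs]), ← Module.End.mul_apply, ← map_mul]
        simp }

theorem coindUnit_comp_coindAverage [Fintype Q] (s : Q → G) (hs : ∀ q, φ (s q) = q) :
    coindUnit φ.ker M ≫ coindAverage φ M s hs = 𝟙 M := by
  ext m
  change (Fintype.card Q : ℚ)⁻¹ • ∑ q, M.ρ (s q)⁻¹ (M.ρ (s q) m) = m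
  have h (q : Q) : M.ρ (s q)⁻¹ (M.ρ (s q) m) = m := by
    rw [← Module.End.mul_apply, ← map_mul, inv_mul_cancel, map_one, Module.End.one_apply]
  simp only [h, Finset.sum_const, Finset.card_univ]
  rw [← Nat.cast_smul_eq_nsmul ℚ, smul_smul, inv_mul_cancel₀, one_smul]
  exact_mod_cast Fintype.card_ne_zero

theorem FiniteRationalCD.of_finite_quotient [Finite Q] (hφ : Function.Surjective φ)
    (h : FiniteRationalCD φ.ker) : FiniteRationalCD G := by
  have := Fintype.ofFinite Q
  choose s hs using hφ
  obtain ⟨N, hN⟩ := h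
  refine ⟨N, fun n hn M => ?_⟩
  exact subsingleton_groupCohomology_of_retract _ _ (coindUnit_comp_coindAverage φ M s hs)
    (subsingleton_groupCohomology_coind _ (hN n hn _))

/-- The endomorphism `f ↦ (x ↦ f x - t⁻¹ • f (t * x))` of the representation of `G` obtained by
restriction to a normal subgroup followed by coinduction. -/
noncomputable def coindDifference (t : G) :
    Rep.coind φ.ker.subtype (Rep.res φ.ker.subtype M) ⟶
      Rep.coind φ.ker.subtype (Rep.res φ.ker.subtype M) :=
  Rep.ofHom
    { toFun := fun f => ⟨fun x => f.1 x - M.ρ t⁻¹ (f.1 (t * x)), fun n x => by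
        have h₁ : f.1 (n.1 * x) = M.ρ n.1 (f.1 x) := f.2 n x
        have h₂ := rho_inv_apply_eq_of_map_eq φ M f (x := t * (n.1 * x)) (y := t * x)
          (by simp [φ.mem_ker.1 n.2])
        have h₃ : M.ρ t⁻¹ (f.1 (t * (n.1 * x))) = M.ρ n.1 (M.ρ t⁻¹ (f.1 (t * x))) := by
          apply_fun M.ρ (n.1 * x) at h₂
          simp only [← Module.End.mul_apply, ← map_mul] at h₂ ⊢
          simpa [mul_assoc] using h₂
        change f.1 (n.1 * x) - M.ρ t⁻¹ (f.1 (t * (n.1 * x))) =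
          M.ρ n.1 (f.1 x - M.ρ t⁻¹ (f.1 (t * x)))
        rw [h₁, h₃, map_sub]⟩
      map_add' := fun f g => by
        ext x
        change f.1 x + g.1 x - M.ρ t⁻¹ (f.1 (t * x) + g.1 (t * x)) =
          (f.1 x - M.ρ t⁻¹ (f.1 (t * x))) + (g.1 x - M.ρ t⁻¹ (g.1 (t * x)))
        rw [map_add, add_sub_add_comm]
      map_smul' := fun c f => by
        ext x
        change c • f.1 x - M.ρ t⁻¹ (c • f.1 (t * x)) = c • (f.1 x - M.ρ t⁻¹ (f.1 (t * x)))
        rw [map_smul, smul_sub]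
      isIntertwining' := fun g => by
        ext f x
        change f.1 (x * g) - M.ρ t⁻¹ (f.1 (t * x * g)) =
          f.1 (x * g) - M.ρ t⁻¹ (f.1 (t * (x * g)))
        rw [mul_assoc] }

theorem coindDifference_apply (t x : G)
    (f : Rep.coind φ.ker.subtype (Rep.res φ.ker.subtype M)) :
    ((coindDifference φ M t).hom f).1 x = f.1 x - M.ρ t⁻¹ (f.1 (t * x)) := rfl

/-- Every integer sequence is the difference sequence of another one. -/
theorem exists_sub_succ_eq {V : Type*} [AddCommGroup V] (w : ℤ → V) :
    ∃ W : ℤ → V, ∀ k, W k - W (k + 1) = w k := by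
  refine ⟨fun k => ∑ i ∈ Finset.Ico k 0, w i - ∑ i ∈ Finset.Ico 0 k, w i, fun k => ?_⟩
  beta_reduce
  rcases lt_or_ge k 0 with h | h
  · rw [Finset.Ico_eq_empty_of_le h.le, Finset.Ico_eq_empty_of_le (Int.add_one_le_of_lt h),
      ← Finset.insert_Ico_add_one_left_eq_Ico h, Finset.sum_insert (by simp)]
    simp
  · rw [Finset.Ico_eq_empty_of_le h, Finset.Ico_eq_empty_of_le (by omega : (0 : ℤ) ≤ k + 1),
      ← Finset.insert_Ico_right_eq_Ico_add_one h, Finset.sum_insert (by simp)]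
    simp

variable (ψ : G →* Multiplicative ℤ)

theorem coindDifference_surjective {t : G} (ht : ψ t = Multiplicative.ofAdd 1) :
    Function.Surjective (coindDifference ψ M t).hom := by
  intro h
  obtain ⟨W, hW⟩ := exists_sub_succ_eq fun k : ℤ => M.ρ (t ^ k)⁻¹ (h.1 (t ^ k))
  refine ⟨⟨fun x => M.ρ x (W (ψ x).toAdd), fun n x => ?_⟩, ?_⟩
  · change M.ρ (n.1 * x) (W (ψ (n.1 * x)).toAdd) = M.ρ n.1 (M.ρ x (W (ψ x).toAdd))
    rw [map_mul ψ, ψ.mem_ker.1 n.2, one_mul, map_mul, Module.End.mul_apply]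
  · ext x
    rw [coindDifference_apply]
    change M.ρ x (W (ψ x).toAdd) - M.ρ t⁻¹ (M.ρ (t * x) (W (ψ (t * x)).toAdd)) = h.1 x
    rw [← Module.End.mul_apply, ← map_mul, inv_mul_cancel_left, ← map_sub, map_mul, ht,
      toAdd_mul, toAdd_ofAdd, add_comm, hW,
      rho_inv_apply_eq_of_map_eq ψ M h (x := t ^ (ψ x).toAdd) (y := x)
        (by rw [map_zpow, ht, ← ofAdd_zsmul]; simp),
      ← Module.End.mul_apply, ← map_mul, mul_inv_cancel, map_one, Module.End.one_apply]

theorem coindUnit_comp_coindDifference (t : G) :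
    coindUnit φ.ker M ≫ coindDifference φ M t = 0 := by
  ext m x
  change M.ρ x m - M.ρ t⁻¹ (M.ρ (t * x) m) = 0
  rw [← Module.End.mul_apply, ← map_mul, inv_mul_cancel_left, sub_self]

theorem eq_coindUnit_of_coindDifference_eq_zero {t : G} (ht : ψ t = Multiplicative.ofAdd 1)
    {f : Rep.coind ψ.ker.subtype (Rep.res ψ.ker.subtype M)}
    (hf : (coindDifference ψ M t).hom f = 0) : f = (coindUnit ψ.ker M).hom (f.1 1) := by
  have hstep (x : G) : M.ρ (t * x)⁻¹ (f.1 (t * x)) = M.ρ x⁻¹ (f.1 x) := by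
    have h₁ : f.1 x - M.ρ t⁻¹ (f.1 (t * x)) = 0 := congrArg (fun f => f.1 x) hf
    rw [sub_eq_zero.1 h₁, mul_inv_rev, map_mul, Module.End.mul_apply]
  have hpow (k : ℤ) : M.ρ (t ^ k)⁻¹ (f.1 (t ^ k)) = f.1 1 := by
    induction k using Int.induction_on with
    | zero => simp
    | succ k ih => rw [add_comm, zpow_add, zpow_one, hstep, ih]
    | pred k ih => rw [← hstep, ← zpow_one_add, add_sub_cancel, ih]
  ext x
  change f.1 x = M.ρ x (f.1 1)
  rw [← hpow (ψ x).toAdd, rho_inv_apply_eq_of_map_eq ψ M f (x := t ^ (ψ x).toAdd) (y := x)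
    (by rw [map_zpow, ht, ← ofAdd_zsmul]; simp),
    ← Module.End.mul_apply, ← map_mul, mul_inv_cancel, map_one, Module.End.one_apply]

theorem coindUnit_coindDifference_shortExact {t : G} (ht : ψ t = Multiplicative.ofAdd 1) :
    (ShortComplex.mk _ _ (coindUnit_comp_coindDifference ψ M t)).ShortExact where
  exact := by
    rw [← ShortComplex.exact_map_iff_of_faithful _ (forget₂ (Rep.{0} ℚ G) (ModuleCat ℚ)),
      ShortComplex.moduleCat_exact_iff]
    intro f hf
    exact ⟨f.1 1, (eq_coindUnit_of_coindDifference_eq_zero M ψ ht hf).symm⟩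
  mono_f := (Rep.mono_iff_injective _).2 fun m m' h => by
    have h₁ : M.ρ 1 m = M.ρ 1 m' := congrArg (fun f => f.1 1) h
    simpa using h₁
  epi_g := (Rep.epi_iff_surjective _).2 (coindDifference_surjective M ψ ht)

theorem FiniteRationalCD.of_int_quotient (hψ : Function.Surjective ψ)
    (h : FiniteRationalCD ψ.ker) : FiniteRationalCD G := by
  obtain ⟨t, ht⟩ := hψ (Multiplicative.ofAdd 1)
  obtain ⟨N, hN⟩ := h
  refine ⟨N + 1, fun n hn M => ?_⟩
  obtain ⟨n, rfl⟩ : ∃ m, n = m + 1 := ⟨n - 1, by omega⟩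
  exact subsingleton_groupCohomology_of_shortExact (coindUnit_coindDifference_shortExact M ψ ht)
    (subsingleton_groupCohomology_coind _ (hN _ (by omega) _))
    (subsingleton_groupCohomology_coind _ (hN _ (by omega) _))

end Cyclic

/-- The class of polycyclic groups: the smallest class containing the cyclic groups and closed
under extensions. -/
inductive IsPolycyclic : (G : Type) → [Group G] → Prop
  | of_isCyclic (G : Type) [Group G] [IsCyclic G] : IsPolycyclic G
  | of_ker {G H : Type} [Group G] [Group H] (f : G →* H) (hf : Function.Surjective f)
      (hker : IsPolycyclic f.ker) (hH : IsPolycyclic H) : IsPolycyclic G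

/-- If the image of `H` under `f` is finitely generated, then `H` is generated by finitely many
elements together with `H ⊓ f.ker`. -/
theorem Subgroup.exists_finite_le_closure_sup_inf_ker {G G' : Type*} [Group G] [Group G']
    (f : G →* G') {H : Subgroup G} (h : (H.map f).FG) :
    ∃ S : Set G, S ⊆ H ∧ S.Finite ∧ H ≤ Subgroup.closure S ⊔ H ⊓ f.ker := by
  obtain ⟨T, hT, hfin⟩ := (Subgroup.fg_iff _).1 h
  have hsub : T ⊆ f '' H := by
    rw [← Subgroup.coe_map, ← hT]
    exact Subgroup.subset_closure
  obtain ⟨S, hSH, hSfin, hS⟩ := Set.exists_subset_image_finite_and.1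
    (⟨T, hsub, hfin, hT⟩ : ∃ t ⊆ f '' H, t.Finite ∧ Subgroup.closure t = H.map f)
  refine ⟨S, hSH, hSfin, fun x hx => ?_⟩
  have hfx : f x ∈ (Subgroup.closure S).map f := by
    rw [MonoidHom.map_closure, hS]
    exact Subgroup.mem_map_of_mem f hx
  obtain ⟨s, hs, hsx⟩ := hfx
  have hker : s⁻¹ * x ∈ H ⊓ f.ker :=
    ⟨H.mul_mem (H.inv_mem ((Subgroup.closure_le H).2 hSH hs)) hx, by
      simp [hsx]⟩
  simpa using Subgroup.mul_mem_sup hs hker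

theorem IsPolycyclic.subgroup_fg {G : Type} [Group G] (hG : IsPolycyclic G) (H : Subgroup G) :
    H.FG := by
  induction hG with
  | of_isCyclic G =>
    obtain ⟨g, hg⟩ := (Subgroup.isCyclic_iff_exists_zpowers_eq_top H).1 inferInstance
    exact (Subgroup.fg_iff _).2
      ⟨{g}, by rw [← Subgroup.zpowers_eq_closure, hg], Set.finite_singleton g⟩
  | of_ker f hf hker hH ihker ihH =>
    obtain ⟨S, hSH, hSfin, hS⟩ := Subgroup.exists_finite_le_closure_sup_inf_ker f (ihH (H.map f))
    have hinf : (H ⊓ f.ker).FG := by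
      rw [← Subgroup.subgroupOf_map_subtype]
      obtain ⟨T, hT, hTfin⟩ := (Subgroup.fg_iff _).1 (ihker (H.subgroupOf f.ker))
      exact (Subgroup.fg_iff _).2
        ⟨_, by rw [← hT, MonoidHom.map_closure], hTfin.image f.ker.subtype⟩
    have heq : H = Subgroup.closure S ⊔ H ⊓ f.ker :=
      le_antisymm hS (sup_le ((Subgroup.closure_le H).2 hSH) inf_le_left)
    rw [heq]
    exact Subgroup.FG.sup ((Subgroup.fg_iff _).2 ⟨S, rfl, hSfin⟩) hinf

theorem isPolycyclic_of_closure_finset (n : ℕ) : ∀ (A : Type) [CommGroup A] (s : Finset A),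
    s.card = n → Subgroup.closure (s : Set A) = ⊤ → IsPolycyclic A := by
  classical
  induction n using Nat.strong_induction_on with
  | _ n ih =>
    intro A _ s hcard hs
    rcases s.eq_empty_or_nonempty with rfl | ⟨a, ha⟩
    · have : Subsingleton A := by
        simpa [eq_comm, subsingleton_iff_bot_eq_top] using hs
      exact .of_isCyclic A
    · let q := QuotientGroup.mk' (Subgroup.zpowers a)
      have hq : Function.Surjective q := QuotientGroup.mk'_surjective _
      have hqa : q a = 1 := (QuotientGroup.eq_one_iff a).2 (Subgroup.mem_zpowers a)
      refine .of_ker q hq ?_ (ih _ ?_ _ ((s.erase a).image q) rfl ?_)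
      · rw [QuotientGroup.ker_mk']
        exact .of_isCyclic _
      · exact Finset.card_image_le.trans_lt (hcard ▸ Finset.card_erase_lt_of_mem ha)
      · rw [← Subgroup.closure_insert_one, ← hqa, ← Finset.coe_insert, ← Finset.image_insert,
          Finset.insert_erase ha, Finset.coe_image, ← MonoidHom.map_closure, hs,
          Subgroup.map_top_of_surjective q hq]

theorem isPolycyclic_of_commGroup_fg (A : Type) [CommGroup A] [hA : Group.FG A] :
    IsPolycyclic A := by
  obtain ⟨s, hs⟩ := Group.fg_def.1 hA
  exact isPolycyclic_of_closure_finset _ A s rfl hs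

open scoped commutatorElement in
/-- If `⁅A, ⊤⁆` is central in a finitely generated group and `A` is finitely generated modulo
`⁅A, ⊤⁆`, then `⁅A, ⊤⁆` is finitely generated. -/
theorem Subgroup.fg_commutator_top_of_le_center {G : Type*} [Group G] [hG : Group.FG G]
    (A : Subgroup G) [A.Normal] (hc : ⁅A, (⊤ : Subgroup G)⁆ ≤ Subgroup.center G)
    (hA : (A.map (QuotientGroup.mk' ⁅A, (⊤ : Subgroup G)⁆)).FG) :
    ⁅A, (⊤ : Subgroup G)⁆.FG := by
  obtain ⟨S, hSA, hSfin, hS⟩ := Subgroup.exists_finite_le_closure_sup_inf_ker _ hA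
  rw [QuotientGroup.ker_mk'] at hS
  obtain ⟨T, hT, hTfin⟩ := Group.fg_iff.1 hG
  set K : Subgroup G := Subgroup.closure (Set.image2 (fun s t => ⁅s, t⁆) S T) with hK
  have hKA : K ≤ ⁅A, (⊤ : Subgroup G)⁆ := by
    rw [hK, Subgroup.closure_le]
    rintro _ ⟨s, hs, t, -, rfl⟩
    exact Subgroup.commutator_mem_commutator (hSA hs) (Subgroup.mem_top t)
  have : K.Normal := ⟨fun k hk g => by
    rwa [Subgroup.mem_center_iff.1 (hc (hKA hk)) g, mul_inv_cancel_right]⟩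
  let q := QuotientGroup.mk' K
  have hq {a g : G} : ⁅a, g⁆ ∈ K ↔ Commute (q a) (q g) := by
    rw [← commutatorElement_eq_one_iff_commute, ← map_commutatorElement]
    exact (QuotientGroup.eq_one_iff _).symm
  have hSK : S ⊆ (Subgroup.center (G ⧸ K)).comap q := by
    intro s hs
    have hle : (⊤ : Subgroup G) ≤ (Subgroup.centralizer {q s}).comap q := by
      rw [← hT, Subgroup.closure_le]
      intro t ht
      exact Subgroup.mem_centralizer_singleton_iff.2
        (hq.1 (Subgroup.subset_closure ⟨s, hs, t, ht, rfl⟩)).symm.eq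
    refine Subgroup.mem_center_iff.2 fun y => ?_
    obtain ⟨g, rfl⟩ := QuotientGroup.mk'_surjective K y
    exact Subgroup.mem_centralizer_singleton_iff.1 (hle (Subgroup.mem_top g))
  have hNK : ⁅A, (⊤ : Subgroup G)⁆ ≤ (Subgroup.center (G ⧸ K)).comap q := by
    intro x hx
    refine Subgroup.mem_center_iff.2 fun y => ?_
    obtain ⟨g, rfl⟩ := QuotientGroup.mk'_surjective K y
    rw [← map_mul, ← map_mul, Subgroup.mem_center_iff.1 (hc hx) g]
  have hAK : A ≤ (Subgroup.center (G ⧸ K)).comap q :=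
    hS.trans (sup_le ((Subgroup.closure_le _).2 hSK) (inf_le_right.trans hNK))
  have heq : ⁅A, (⊤ : Subgroup G)⁆ = K := by
    refine le_antisymm (Subgroup.commutator_le.2 fun a ha g _ => hq.2 ?_) hKA
    exact (Subgroup.mem_center_iff.1 (hAK ha) (q g)).symm
  rw [heq]
  exact (Subgroup.fg_iff _).2 ⟨_, rfl, hSfin.image2 _ hTfin⟩

theorem isPolycyclic_of_lowerCentralSeries_eq_bot (n : ℕ) : ∀ (G : Type) [Group G] [Group.FG G],
    Subgroup.lowerCentralSeries (⊤ : Subgroup G) n = ⊥ → IsPolycyclic G := by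
  induction n with
  | zero =>
    intro G _ _ h
    have : Subsingleton G := by
      simpa [eq_comm, subsingleton_iff_bot_eq_top] using h
    exact .of_isCyclic G
  | succ n ih =>
    intro G _ hG h
    set N := Subgroup.lowerCentralSeries (⊤ : Subgroup G) n with hN
    have hc : N ≤ Subgroup.center G := Subgroup.commutator_top_right_eq_bot_iff_le_center.1 h
    let q := QuotientGroup.mk' N
    have hq : Function.Surjective q := QuotientGroup.mk'_surjective N
    have hquot : IsPolycyclic (G ⧸ N) := by
      refine ih (G ⧸ N) ?_
      rw [← Subgroup.map_top_of_surjective q hq, ← Subgroup.map_lowerCentralSeries, ← hN]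
      exact QuotientGroup.map_mk'_self N
    have hfg : N.FG := by
      cases n with
      | zero => exact Group.fg_def.1 hG
      | succ m => exact Subgroup.fg_commutator_top_of_le_center _ hc (hquot.subgroup_fg _)
    have : Group.FG N := (Group.fg_iff_subgroup_fg N).2 hfg
    let _ : CommGroup N :=
      { (inferInstance : Group N) with
        mul_comm := fun x y => Subtype.ext (Subgroup.mem_center_iff.1 (hc y.2) x) }
    refine .of_ker q hq ?_ hquot
    rw [QuotientGroup.ker_mk']
    exact isPolycyclic_of_commGroup_fg N

theorem isPolycyclic_of_isNilpotent (G : Type) [Group G] [Group.FG G] [hG : Group.IsNilpotent G] :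
    IsPolycyclic G := by
  obtain ⟨n, hn⟩ := Subgroup.nilpotent_iff_lowerCentralSeries.1 hG
  exact isPolycyclic_of_lowerCentralSeries_eq_bot n G hn

theorem IsPolycyclic.finiteRationalCD_of_ker {Q : Type} [Group Q] (hQ : IsPolycyclic Q) :
    ∀ {G : Type} [Group G] (φ : G →* Q), Function.Surjective φ → FiniteRationalCD φ.ker →
      FiniteRationalCD G := by
  induction hQ with
  | of_isCyclic Q =>
    intro G _ φ hφ hker
    rcases finite_or_infinite Q with hfin | hinf
    · exact .of_finite_quotient φ hφ hker
    · let e : Q ≃* Multiplicative ℤ := intCyclicMulEquiv.symm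
      refine .of_int_quotient (e.toMonoidHom.comp φ) (e.surjective.comp hφ) ?_
      have : (e.toMonoidHom.comp φ).ker = φ.ker := MonoidHom.ker_mulEquiv_comp φ e
      rwa [this]
  | @of_ker Q R _ _ p hp hker hR ihker ihR =>
    intro G _ φ hφ h
    refine ihR (p.comp φ) (hp.comp hφ) ?_
    let ψ : (p.comp φ).ker →* p.ker :=
      (φ.comp (p.comp φ).ker.subtype).codRestrict p.ker fun x => x.2
    have hψ : Function.Surjective ψ := by
      rintro ⟨y, hy⟩
      obtain ⟨g, rfl⟩ := hφ y
      exact ⟨⟨g, hy⟩, rfl⟩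
    refine ihker ψ hψ (.of_mulEquiv ?_ h)
    exact
      { toFun := fun g => ⟨⟨g.1, by simp [MonoidHom.mem_ker, φ.mem_ker.1 g.2]⟩,
          Subtype.ext (φ.mem_ker.1 g.2)⟩
        invFun := fun g => ⟨g.1.1, congrArg Subtype.val (ψ.mem_ker.1 g.2)⟩
        left_inv := fun _ => rfl
        right_inv := fun _ => rfl
        map_mul' := fun _ _ => rfl }

theorem finiteRationalCD_of_subsingleton (G : Type) [Group G] [Subsingleton G] :
    FiniteRationalCD G := by
  refine ⟨0, fun n hn M => ?_⟩
  obtain ⟨n, rfl⟩ : ∃ m, n = m + 1 := ⟨n - 1, by omega⟩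
  exact ModuleCat.subsingleton_of_isZero (isZero_groupCohomology_succ_of_subsingleton M n)

theorem IsPolycyclic.finiteRationalCD {G : Type} [Group G] (hG : IsPolycyclic G) :
    FiniteRationalCD G := by
  refine hG.finiteRationalCD_of_ker (MonoidHom.id G) Function.surjective_id ?_
  have : Subsingleton (MonoidHom.id G).ker := by
    rw [MonoidHom.ker_id]
    infer_instance
  exact finiteRationalCD_of_subsingleton _

end

/-- **Finiteness of rational cohomological dimension of finitely generated nilpotent
groups (used in Proposition 2.1.1(iii)).** Every finitely generated nilpotent group has
finite rational cohomological dimension: there is `N` such that the group cohomology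
`Hⁿ(G; M)` vanishes for all `n > N` and all `ℚ`-linear representations `M` of `G`. -/
theorem stmt_16 (G : Type) [Group G] [Group.FG G] (hnil : Group.IsNilpotent G) :
    ∃ N : ℕ, ∀ n : ℕ, n > N → ∀ M : Rep ℚ G,
      Subsingleton (groupCohomology M n) := by
  exact (isPolycyclic_of_isNilpotent G).finiteRationalCD
end
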